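/- arXiv:2206.00173 — 3 statements merged into one kernel-verified Lean document; each statement's English description precedes it below -/
import Mathlib

section
/- Let A be a multipartition matrix with k blocks and pairwise distinct columns that is staged and balanced (equivalently, A is the matrix of a stratified, balanced staged tree). Then A satisfies the generalized running intersection property (GRIP). -/
open Finset

namespace PM

variable {k : ℕ} {J : Type*} {I : Type*} [Fintype J] [DecidableEq J] [DecidableEq I]

/- A partition matrix (a 0/1 matrix in which every column sums to 1), with columns
indexed by `J` and rows indexed by `I`, is encoded by the map sending each column to the
unique row having a 1 in that column.  A multipartition matrix with `k` blocks is a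
family `S : Fin k → J → I` of such maps (block `b` is the partition matrix whose row
through column `j` is `S b j`). -/

/-- Columns `j` and `j'` agree in the first `ℓ` blocks (blocks of index `< ℓ`). -/
def colEquiv (S : Fin k → J → I) (ℓ : ℕ) (j j' : J) : Prop :=
  ∀ b : Fin k, (b : ℕ) < ℓ → S b j = S b j'

instance {S : Fin k → J → I} {ℓ : ℕ} {j j' : J} : Decidable (colEquiv S ℓ j j') :=
  inferInstanceAs (Decidable (∀ b : Fin k, (b : ℕ) < ℓ → S b j = S b j'))

/-- The column weight `c^ℓ_j` of column `j` in the stacked matrix of the first `ℓ` blocks. -/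
def colWeight (S : Fin k → J → I) (ℓ : ℕ) (j : J) : ℕ :=
  (univ.filter fun j' => colEquiv S ℓ j j').card

/-- Well-connectedness: for every block `b` and all columns `j`, `j'` in the support of one
row of block `b`, `c^{b+1}_j / c^{b}_j = c^{b+1}_{j'} / c^{b}_{j'}` (cross-multiplied;
here `b+1` counts blocks, so `colWeight S ((b:ℕ)+1)` includes block `b`, and the
condition is trivially true for the first block). -/
def WellConnected (S : Fin k → J → I) : Prop :=
  ∀ (b : Fin k) (j j' : J), S b j = S b j' →
    colWeight S ((b : ℕ) + 1) j * colWeight S (b : ℕ) j' =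
      colWeight S ((b : ℕ) + 1) j' * colWeight S (b : ℕ) j

/-- The set of rows of block `b` connected to the row of `B_b = ∪_{n<b} A^n` supported
on column `j` (a floret of block `b`, represented by the column `j`). -/
def stage (S : Fin k → J → I) (b : Fin k) (j : J) : Finset I :=
  (univ.filter fun j' => colEquiv S (b : ℕ) j j').image (S b)

/-- The pair `(∪_{n<b} A^n, A^b)` satisfies the floret condition: the sets of rows of the
block `b` connected to two rows of `B_b` are equal or disjoint. -/
def FloretCondition (S : Fin k → J → I) (b : Fin k) : Prop :=
  ∀ j j' : J, stage S b j = stage S b j' ∨ Disjoint (stage S b j) (stage S b j')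

/-- The `i`-th row of block `b`, as a real vector. -/
def rowVec (S : Fin k → J → I) (b : Fin k) (i : I) : J → ℝ :=
  fun j => if S b j = i then 1 else 0

/-- `α^b_i · d`, the dot product of the `i`-th row of block `b` with `d`. -/
def rowDot (S : Fin k → J → I) (b : Fin k) (i : I) (d : J → ℝ) : ℝ :=
  ∑ j, (if S b j = i then d j else 0)

/-- The set of rows of the stacked matrix consisting of the first `ℓ` blocks. -/
def prefixRows (S : Fin k → J → I) (ℓ : ℕ) : Set (J → ℝ) :=
  {v | ∃ (b : Fin k) (i : I), (b : ℕ) < ℓ ∧ v = rowVec S b i}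

/-- The row of `D = B_b ∩ A^b` through column `j0` (the indicator vector of the columns
whose floret pair is that of `j0`). -/
def dRow (S : Fin k → J → I) (b : Fin k) (j0 : J) : J → ℝ :=
  fun j => if stage S b j = stage S b j0 then 1 else 0

/-- The generalized running intersection property: for every block `b ≥ 1` (paper:
`ℓ + 1` with `1 ≤ ℓ ≤ k-1`), (1) the stacked matrix of `B_b = ∪_{n<b}A^n` and `A^b` is
well-connected, (2) the pair `(B_b, A^b)` satisfies the floret condition, and (3) every
row of `B_b ∩ A^b` lies in the real row span of the first `b` blocks. -/
def GRIP (S : Fin k → J → I) : Prop :=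
  ∀ b : Fin k, 0 < (b : ℕ) →
    (∀ j j' : J, S b j = S b j' →
      colWeight S ((b : ℕ) + 1) j * colWeight S (b : ℕ) j' =
        colWeight S ((b : ℕ) + 1) j' * colWeight S (b : ℕ) j) ∧
    FloretCondition S b ∧
    (∀ j0 : J, dRow S b j0 ∈ Submodule.span ℝ (prefixRows S (b : ℕ)))

/-- The level-`b` floret `F^b[i]` containing the `i`-th row of block `b`. -/
def floret (S : Fin k → J → I) (b : Fin k) (i : I) : Finset I :=
  (univ.filter fun j => S b j = i).biUnion fun j => stage S b j

/-- `Σ_{i' ∈ F^b[i]} α^b_{i'} · d`. -/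
def floretSum (S : Fin k → J → I) (b : Fin k) (i : I) (d : J → ℝ) : ℝ :=
  ∑ j, (if S b j ∈ floret S b i then d j else 0)

/-- The likelihood `∏_j p_j^{d_j}` of data `d` at the point `p`. -/
noncomputable def likelihood (d p : J → ℝ) : ℝ := ∏ j, p j ^ d j

/-- The log-linear (partition) model determined by a set of rows: probability
vectors with positive entries whose coordinatewise logarithm lies in the row span. -/
def inModel (Rows : Set (J → ℝ)) (p : J → ℝ) : Prop :=
  (∀ j, 0 < p j) ∧ (∑ j, p j) = 1 ∧
    (fun j => Real.log (p j)) ∈ Submodule.span ℝ Rows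

/-- `p` is a maximum likelihood estimate for the data `d` in the model determined by
`Rows`: it maximizes the likelihood over the closure of the model. -/
def IsMLE (Rows : Set (J → ℝ)) (d p : J → ℝ) : Prop :=
  p ∈ closure {q | inModel Rows q} ∧
    ∀ q ∈ closure {q | inModel Rows q}, likelihood d q ≤ likelihood d p

/-- The iterative proportional scaling iterates: `ips S d 0` is the uniform
distribution, and step `ℓ+1` rescales by the `ℓ`-th block (`q^{ℓ+1}_j =
q^ℓ_j ⬝ (α^ℓ_{S(ℓ,j)} · d) / (α^ℓ_{S(ℓ,j)} · q^ℓ)`). -/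
noncomputable def ips (S : Fin k → J → I) (d : J → ℝ) : ℕ → J → ℝ
  | 0 => fun _ => (Fintype.card J : ℝ)⁻¹
  | ℓ + 1 => fun j =>
      if h : ℓ < k then
        ips S d ℓ j * rowDot S ⟨ℓ, h⟩ (S ⟨ℓ, h⟩ j) d /
          rowDot S ⟨ℓ, h⟩ (S ⟨ℓ, h⟩ j) (ips S d ℓ)
      else ips S d ℓ j

end PM

namespace PM

variable {k : ℕ} {J : Type*} {I : Type*} [Fintype J] [DecidableEq J] [DecidableEq I]

/-- A multipartition matrix with pairwise distinct columns is *staged* if its associated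
tree is a staged tree: for each level, the stages (sets of next-level rows reachable from
two columns agreeing up to that level) are equal or disjoint. -/
def Staged (S : Fin k → J → I) : Prop :=
  ∀ b : Fin k, 0 < (b : ℕ) → FloretCondition S b

/-- The interpolating polynomial `t_ℓ(j)` of the vertex of the tree determined by the
first `ℓ` edges along the root-to-leaf path of column `j`: the sum over all columns `j'`
agreeing with `j` in the first `ℓ` blocks of the product of the variables of their
remaining edges. -/
noncomputable def interp (S : Fin k → J → I) (ℓ : ℕ) (j : J) :
    MvPolynomial (Fin k × I) ℝ :=
  ∑ j' ∈ Finset.univ.filter (fun j' => colEquiv S ℓ j j'),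
    ∏ b ∈ Finset.univ.filter (fun b : Fin k => ℓ ≤ (b : ℕ)),
      MvPolynomial.X (b, S b j')

/-- A staged multipartition matrix with pairwise distinct columns is *balanced* if for
every level `b ≥ 1`, any two vertices in the same stage (columns `j`, `j''` with equal
stages), and any matching pairs of children (columns `j₁, j₂ ∼_b j` and
`j₁'', j₂'' ∼_b j''` with `S b j₁ = S b j₁''` and `S b j₂ = S b j₂''`), one has
`t(j₁) t(j₂'') = t(j₁'') t(j₂)` as polynomials. -/
def Balanced (S : Fin k → J → I) : Prop :=
  ∀ b : Fin k, 0 < (b : ℕ) →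
    ∀ j j'' : J, stage S b j = stage S b j'' →
      ∀ j₁ j₂ j₁'' j₂'' : J,
        colEquiv S (b : ℕ) j j₁ → colEquiv S (b : ℕ) j j₂ →
        colEquiv S (b : ℕ) j'' j₁'' → colEquiv S (b : ℕ) j'' j₂'' →
        S b j₁ = S b j₁'' → S b j₂ = S b j₂'' →
        interp S ((b : ℕ) + 1) j₁ * interp S ((b : ℕ) + 1) j₂'' =
          interp S ((b : ℕ) + 1) j₁'' * interp S ((b : ℕ) + 1) j₂

end PM

namespace PM

section Helpers

variable {k : ℕ} {J : Type*} {I : Type*} [Fintype J] [DecidableEq J] [DecidableEq I]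

theorem colEquiv_refl' (S : Fin k → J → I) (l : ℕ) (j : J) : colEquiv S l j j :=
  fun _ _ => rfl

theorem colEquiv_succ_iff (S : Fin k → J → I) (b : Fin k) (j j' : J) :
    colEquiv S ((b : ℕ) + 1) j j' ↔ colEquiv S (b : ℕ) j j' ∧ S b j = S b j' := by
  constructor
  · intro h
    exact ⟨fun c hc => h c (by omega), h b (by omega)⟩
  · rintro ⟨h, hb⟩ c hc
    rcases Nat.lt_succ_iff_lt_or_eq.mp hc with h1 | h1
    · exact h c h1
    · have : c = b := Fin.ext h1
      rw [this]; exact hb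

theorem stage_congr (S : Fin k → J → I) (b : Fin k) (j j' : J)
    (h : colEquiv S (b : ℕ) j j') : stage S b j = stage S b j' := by
  unfold stage
  congr 1
  ext x
  simp only [mem_filter, mem_univ, true_and]
  exact ⟨fun hx c hc => (h c hc).symm.trans (hx c hc), fun hx c hc => (h c hc).trans (hx c hc)⟩

theorem mem_stage (S : Fin k → J → I) (b : Fin k) (j : J) (i : I) :
    i ∈ stage S b j ↔ ∃ r, colEquiv S (b : ℕ) j r ∧ S b r = i := by
  simp [stage]

theorem mem_stage_self (S : Fin k → J → I) (b : Fin k) (j : J) : S b j ∈ stage S b j :=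
  (mem_stage S b j _).2 ⟨j, colEquiv_refl' S _ j, rfl⟩

theorem inner_sum (S : Fin k → J → I) (b : Fin k) (j r : J) (hr : colEquiv S (b : ℕ) j r) :
    (∑ j' ∈ (univ.filter (fun j' => colEquiv S (b : ℕ) j j')).filter (fun j' => S b j' = S b r),
      ∏ c ∈ univ.filter (fun c : Fin k => (b : ℕ) ≤ (c : ℕ)),
        (MvPolynomial.X (c, S c j') : MvPolynomial (Fin k × I) ℝ)) =
      MvPolynomial.X (b, S b r) * interp S ((b : ℕ) + 1) r := by
  unfold interp
  rw [mul_sum]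
  refine sum_congr ?_ ?_
  · ext x
    simp only [mem_filter, mem_univ, true_and, colEquiv_succ_iff]
    constructor
    · rintro ⟨h1, h2⟩
      exact ⟨fun c hc => (hr c hc).symm.trans (h1 c hc), h2.symm⟩
    · rintro ⟨h1, h2⟩
      exact ⟨fun c hc => (hr c hc).trans (h1 c hc), h2.symm⟩
  · intro x hx
    have hxb : S b r = S b x := by
      simp only [mem_filter, mem_univ, true_and, colEquiv_succ_iff] at hx
      exact hx.2
    have hset : univ.filter (fun c : Fin k => (b : ℕ) ≤ (c : ℕ)) =
        insert b (univ.filter (fun c : Fin k => (b : ℕ) + 1 ≤ (c : ℕ))) := by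
      ext c
      simp only [mem_filter, mem_univ, true_and, mem_insert, Fin.ext_iff]
      omega
    rw [hset, prod_insert (by simp), hxb]

theorem interp_fiber (S : Fin k → J → I) (b : Fin k) (j : J) :
    interp S (b : ℕ) j = ∑ i ∈ stage S b j,
      ∑ j' ∈ (univ.filter (fun j' => colEquiv S (b : ℕ) j j')).filter (fun j' => S b j' = i),
      ∏ c ∈ univ.filter (fun c : Fin k => (b : ℕ) ≤ (c : ℕ)),
        (MvPolynomial.X (c, S c j') : MvPolynomial (Fin k × I) ℝ) := by
  unfold interp
  rw [sum_fiberwise_of_maps_to]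
  intro x hx
  simp only [mem_filter, mem_univ, true_and] at hx
  exact (mem_stage S b j _).2 ⟨x, hx, rfl⟩

theorem stage_eq_of_mem (S : Fin k → J → I) (b : Fin k) (hst : FloretCondition S b) (j j' : J)
    (h : S b j ∈ stage S b j') : stage S b j = stage S b j' := by
  rcases hst j j' with h1 | h1
  · exact h1
  · exact absurd h (Finset.disjoint_left.1 h1 (mem_stage_self S b j))

theorem interp_ratio (S : Fin k → J → I) (hst : Staged S) (hbal : Balanced S) (b : Fin k)
    (j j' : J) (h : S b j = S b j') :
    interp S ((b : ℕ) + 1) j * interp S (b : ℕ) j' =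
      interp S ((b : ℕ) + 1) j' * interp S (b : ℕ) j := by
  by_cases hb : 0 < (b : ℕ)
  · have hs : stage S b j = stage S b j' :=
      stage_eq_of_mem S b (hst b hb) j j' (h ▸ mem_stage_self S b j')
    rw [interp_fiber S b j, interp_fiber S b j', hs, mul_sum, mul_sum]
    refine sum_congr rfl ?_
    intro i hi
    obtain ⟨r', hr', hri'⟩ := (mem_stage S b j' i).1 hi
    obtain ⟨r, hr, hri⟩ := (mem_stage S b j i).1 (hs ▸ hi)
    have e1 := inner_sum S b j r hr
    have e2 := inner_sum S b j' r' hr'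
    rw [hri] at e1
    rw [hri'] at e2
    rw [e1, e2]
    have := hbal b hb j j' hs j r j' r' (colEquiv_refl' S _ j) hr (colEquiv_refl' S _ j') hr' h
      (hri.trans hri'.symm)
    linear_combination (MvPolynomial.X (b, i)) * this
  · have hb0 : (b : ℕ) = 0 := by omega
    have hc : colEquiv S (b : ℕ) j j' := fun c hc => by omega
    have hc1 : colEquiv S ((b : ℕ) + 1) j j' := (colEquiv_succ_iff S b j j').2 ⟨hc, h⟩
    have key : ∀ l, colEquiv S l j j' → interp S l j = interp S l j' := by
      intro l hl
      unfold interp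
      refine sum_congr ?_ (fun _ _ => rfl)
      ext x
      simp only [mem_filter, mem_univ, true_and]
      exact ⟨fun hx c hc => (hl c hc).symm.trans (hx c hc),
        fun hx c hc => (hl c hc).trans (hx c hc)⟩
    rw [key _ hc, key _ hc1]

theorem eval_interp (S : Fin k → J → I) (l : ℕ) (j : J) :
    MvPolynomial.eval (fun _ => (1 : ℝ)) (interp S l j) = colWeight S l j := by
  simp [interp, colWeight]

theorem colWeight_pos (S : Fin k → J → I) (l : ℕ) (j : J) : 0 < colWeight S l j := by
  unfold colWeight
  exact card_pos.2 ⟨j, by simp [colEquiv_refl']⟩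

/-- Substitution sending the block-`b` variables in `s` to `X` and everything else to `1`. -/
noncomputable def subst (b : Fin k) (s : Finset I) :
    MvPolynomial (Fin k × I) ℝ →ₐ[ℝ] Polynomial ℝ :=
  MvPolynomial.aeval (fun p : Fin k × I => if p.1 = b ∧ p.2 ∈ s then Polynomial.X else 1)

theorem subst_ne_zero (S : Fin k → J → I) (b : Fin k) (s : Finset I) (l : ℕ) (j : J) :
    subst b s (interp S l j) ≠ 0 := by
  intro h0
  have h1 : Polynomial.eval 1 (subst b s (interp S l j)) = (colWeight S l j : ℝ) := by
    simp only [subst, interp, map_sum, map_prod, MvPolynomial.aeval_X, Polynomial.eval_finsetSum,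
      Polynomial.eval_prod, colWeight]
    rw [card_eq_sum_ones, Nat.cast_sum]
    refine sum_congr rfl ?_
    intro x _
    rw [Nat.cast_one]
    refine prod_eq_one ?_
    intro c _
    split_ifs <;> simp
  rw [h0] at h1
  have := colWeight_pos S l j
  rw [Polynomial.eval_zero] at h1
  have h2 : colWeight S l j = 0 := by exact_mod_cast h1.symm
  omega

theorem subst_top (S : Fin k → J → I) (b : Fin k) (hst : FloretCondition S b) (j j0 : J) :
    ((subst b (stage S b j0) (interp S (b : ℕ) j)).natDegree : ℝ) = dRow S b j0 j := by
  have hmon : ∀ x ∈ univ.filter (fun x => colEquiv S (b : ℕ) j x),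
      subst b (stage S b j0) (∏ c ∈ univ.filter (fun c : Fin k => (b : ℕ) ≤ (c : ℕ)),
        MvPolynomial.X (c, S c x)) =
      if stage S b j = stage S b j0 then Polynomial.X else 1 := by
    intro x hx
    simp only [mem_filter, mem_univ, true_and] at hx
    simp only [subst, map_prod, MvPolynomial.aeval_X]
    rw [prod_eq_single_of_mem b (by simp)]
    · have : S b x ∈ stage S b j0 ↔ stage S b j = stage S b j0 := by
        rw [stage_congr S b j x hx]
        exact ⟨stage_eq_of_mem S b hst x j0, fun h => h ▸ mem_stage_self S b x⟩
      simp [this]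
    · intro c _ hc
      simp [hc]
  have hsum : subst b (stage S b j0) (interp S (b : ℕ) j) =
      Polynomial.C (colWeight S (b : ℕ) j : ℝ) *
        (if stage S b j = stage S b j0 then Polynomial.X else 1) := by
    unfold interp
    rw [map_sum, sum_congr rfl hmon, sum_const]
    simp [colWeight, nsmul_eq_mul]
  have hpos : (colWeight S (b : ℕ) j : ℝ) ≠ 0 := by
    have := colWeight_pos S (b : ℕ) j
    positivity
  rw [hsum, Polynomial.natDegree_C_mul hpos]
  unfold dRow
  split_ifs <;> simp

theorem mem_span_of_factors (S : Fin k → J → I) (b : Fin k) (l : ℕ) (hl : (b : ℕ) < l)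
    (f : J → ℝ) (hf : ∀ j j', S b j = S b j' → f j = f j') :
    f ∈ Submodule.span ℝ (prefixRows S l) := by
  have hfac : Function.FactorsThrough f (S b) := fun j j' h => hf j j' h
  have : f = ∑ i ∈ univ.image (S b), (Function.extend (S b) f 0 i) • rowVec S b i := by
    funext j
    rw [Finset.sum_apply]
    simp only [rowVec, Pi.smul_apply, smul_eq_mul, mul_ite, mul_one, mul_zero]
    rw [sum_ite_eq, if_pos (by simp), hfac.extend_apply]
  rw [this]
  exact Submodule.sum_mem _ fun i _ =>
    Submodule.smul_mem _ _ (Submodule.subset_span ⟨b, i, hl, rfl⟩)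

theorem deg_mem_span (S : Fin k → J → I) (hst : Staged S) (hbal : Balanced S) (b : Fin k)
    (hb : 0 < (b : ℕ)) (s : Finset I) (l : ℕ) (hl : l ≤ (b : ℕ)) :
    (fun j => ((subst b s (interp S l j)).natDegree : ℝ)) ∈
      Submodule.span ℝ (prefixRows S (b : ℕ)) := by
  induction l with
  | zero =>
    refine mem_span_of_factors S ⟨0, by omega⟩ _ hb _ ?_
    intro j j' _
    have : interp S 0 j = interp S 0 j' := by
      simp [interp, colEquiv]
    simp only [this]
  | succ l ih =>
    have ih := ih (by omega)
    have hd : (fun j => ((subst b s (interp S (l + 1) j)).natDegree : ℝ)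
        - ((subst b s (interp S l j)).natDegree : ℝ)) ∈
        Submodule.span ℝ (prefixRows S (b : ℕ)) := by
      refine mem_span_of_factors S ⟨l, by omega⟩ _ (by simp; omega) _ ?_
      intro j j' h
      have e := interp_ratio S hst hbal ⟨l, by omega⟩ j j' h
      have e2 := congrArg (fun p => (subst b s p).natDegree) e
      simp only [map_mul] at e2
      rw [Polynomial.natDegree_mul (subst_ne_zero S b s _ _) (subst_ne_zero S b s _ _),
        Polynomial.natDegree_mul (subst_ne_zero S b s _ _) (subst_ne_zero S b s _ _)] at e2
      have e3 : (((subst b s (interp S (l + 1) j)).natDegree : ℝ)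
        + ((subst b s (interp S l j')).natDegree : ℝ)) =
        ((subst b s (interp S (l + 1) j')).natDegree : ℝ)
        + ((subst b s (interp S l j)).natDegree : ℝ) := by exact_mod_cast e2
      linarith
    have := Submodule.add_mem _ hd ih
    convert this using 1
    funext j
    simp

end Helpers

end PM

open Finset PM in
/-- Theorem 4.5.  Let `A` (encoded by `S`) be a multipartition matrix
with `k` blocks and pairwise distinct columns which is staged and balanced (equivalently,
`A` is the matrix of a stratified, balanced staged tree).  Then `A` satisfies the
generalized running intersection property. -/
theorem balanced_implies_grip {k m : ℕ} (S : Fin k → Fin m → ℕ)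
    (hdist : ∀ j j' : Fin m, (∀ b : Fin k, S b j = S b j') → j = j')
    (hstaged : Staged S) (hbal : Balanced S) :
    GRIP S := by
  intro b hb
  refine ⟨?_, hstaged b hb, ?_⟩
  · intro j j' h
    have e := congrArg (MvPolynomial.eval (fun _ => (1 : ℝ))) (interp_ratio S hstaged hbal b j j' h)
    simp only [map_mul, eval_interp] at e
    exact_mod_cast e
  · intro j0
    have h := deg_mem_span S hstaged hbal b hb (stage S b j0) (b : ℕ) le_rfl
    have e : (fun j => ((subst b (stage S b j0) (interp S (b : ℕ) j)).natDegree : ℝ)) =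
        dRow S b j0 := funext fun j => subst_top S b (hstaged b hb) j j0
    rwa [e] at h
end

section
/- Let A be a multipartition matrix with k blocks satisfying the GRIP, and let Ā be the matrix obtained from A by removing all repeated columns. Then Ā is staged and balanced; that is, the tree T_A associated to A is a stratified, balanced staged tree. -/
open Finset

namespace PM

/-- The pairs of columns `(p, q)` and `(p', q')` have the same multiset of labels in each of the
first `c` blocks. -/
def SameLabels {k : ℕ} {J I : Type*} (S : Fin k → J → I) (c : ℕ) (p q p' q' : J) : Prop :=
  ∀ a : Fin k, (a : ℕ) < c →
    (S a p = S a p' ∧ S a q = S a q') ∨ (S a p = S a q' ∧ S a q = S a p')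

theorem span_pair {k : ℕ} {J I : Type*} [DecidableEq I] (S : Fin k → J → I) (c : ℕ)
    (p q p' q' : J) (h : SameLabels S c p q p' q') (v : J → ℝ)
    (hv : v ∈ Submodule.span ℝ (prefixRows S c)) : v p + v q = v p' + v q' := by
  induction hv using Submodule.span_induction with
  | mem x hx =>
    obtain ⟨b, i, hb, rfl⟩ := hx
    rcases h b hb with ⟨h1, h2⟩ | ⟨h1, h2⟩
    · simp only [rowVec, h1, h2]
    · simp only [rowVec, h1, h2]; ring
  | zero => simp
  | add x y _ _ hx hy => simp only [Pi.add_apply]; linarith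
  | smul a x _ hx => simp only [Pi.smul_apply, smul_eq_mul]; rw [← mul_add, hx, mul_add]

theorem stage_pair {k : ℕ} {J I : Type*} [Fintype J] [DecidableEq J] [DecidableEq I]
    (S : Fin k → J → I) (hg : GRIP S) (b : Fin k) (hb : 0 < (b : ℕ))
    (p q p' q' : J) (h : SameLabels S b p q p' q') :
    (stage S b p = stage S b p' ∧ stage S b q = stage S b q') ∨
      (stage S b p = stage S b q' ∧ stage S b q = stage S b p') := by
  have h1 := span_pair S b p q p' q' h _ ((hg b hb).2.2 p)
  have h2 := span_pair S b p q p' q' h _ ((hg b hb).2.2 q)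
  simp only [dRow] at h1 h2
  by_cases e1 : stage S b p = stage S b p'
  · left
    refine ⟨e1, ?_⟩
    by_contra e2
    have e2' : ¬ stage S b q' = stage S b q := fun h => e2 h.symm
    simp [e1, e2'] at h2
  · right
    have e1' : ¬ stage S b p' = stage S b p := fun h => e1 h.symm
    by_cases e3 : stage S b q' = stage S b p
    · refine ⟨e3.symm, ?_⟩
      by_contra e4
      have e4' : ¬ stage S b p' = stage S b q := fun h => e4 h.symm
      simp [e3, e4'] at h2
    · exfalso
      simp only [e1', e3, if_true, if_false] at h1
      split_ifs at h1 <;> norm_num at h1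

/-- Sum of the remaining monomials over the columns through the child `i` of the vertex of `j`. -/
noncomputable def childSum {k : ℕ} {J I : Type*} [Fintype J] [DecidableEq J] [DecidableEq I]
    (S : Fin k → J → I) (b : Fin k) (j : J) (i : I) : MvPolynomial (Fin k × I) ℝ :=
  ∑ j' ∈ (Finset.univ.filter (fun j' => colEquiv S (b : ℕ) j j')).filter (fun j' => S b j' = i),
    ∏ a ∈ Finset.univ.filter (fun a : Fin k => (b : ℕ) + 1 ≤ (a : ℕ)),
      MvPolynomial.X (a, S a j')

theorem interp_eq {k : ℕ} {J I : Type*} [Fintype J] [DecidableEq J] [DecidableEq I]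
    (S : Fin k → J → I) (b : Fin k) (j : J) :
    interp S b j = ∑ i ∈ stage S b j, MvPolynomial.X (b, i) * childSum S b j i := by
  have hf : (Finset.univ.filter (fun a : Fin k => (b : ℕ) ≤ (a : ℕ))) =
      insert b (Finset.univ.filter (fun a : Fin k => (b : ℕ) + 1 ≤ (a : ℕ))) := by
    ext a
    simp only [mem_filter, mem_univ, true_and, mem_insert, Fin.ext_iff]
    omega
  unfold interp stage childSum
  rw [← Finset.sum_fiberwise_of_maps_to (fun x hx => Finset.mem_image_of_mem (S b) hx)]
  refine Finset.sum_congr rfl fun i _ => ?_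
  rw [Finset.mul_sum]
  refine Finset.sum_congr rfl fun x hx => ?_
  rw [hf, Finset.prod_insert (by simp), (Finset.mem_filter.1 hx).2]

theorem childSum_eq {k : ℕ} {J I : Type*} [Fintype J] [DecidableEq J] [DecidableEq I]
    (S : Fin k → J → I) (b : Fin k) (j j₁ : J) (h : colEquiv S b j j₁) :
    childSum S b j (S b j₁) = interp S ((b : ℕ) + 1) j₁ := by
  unfold childSum interp
  refine Finset.sum_congr ?_ fun _ _ => rfl
  ext x
  simp only [mem_filter, mem_univ, true_and]
  constructor
  · rintro ⟨h1, h2⟩ a ha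
    rcases Nat.lt_succ_iff_lt_or_eq.1 ha with ha | ha
    · rw [← h a ha, h1 a ha]
    · obtain rfl : a = b := Fin.ext ha
      exact h2.symm
  · intro h1
    exact ⟨fun a ha => (h a ha).trans (h1 a (by omega)), (h1 b (by omega)).symm⟩

theorem interp_pair {k : ℕ} {J I : Type*} [Fintype J] [DecidableEq J] [DecidableEq I]
    (S : Fin k → J → I) (hinj : ∀ j j', colEquiv S k j j' → j = j')
    (hst : ∀ b : Fin k, 0 < (b : ℕ) → ∀ p q p' q' : J, SameLabels S b p q p' q' →
      (stage S b p = stage S b p' ∧ stage S b q = stage S b q') ∨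
      (stage S b p = stage S b q' ∧ stage S b q = stage S b p'))
    (n : ℕ) : ∀ c : ℕ, 0 < c → c + n = k → ∀ p q p' q' : J, SameLabels S c p q p' q' →
      interp S c p * interp S c q = interp S c p' * interp S c q' := by
  induction n with
  | zero =>
    intro c _ hk p q p' q' _
    obtain rfl : c = k := hk
    have h1 : ∀ j, interp S c j = 1 := by
      intro j
      unfold interp
      have e1 : (Finset.univ.filter (fun j' => colEquiv S c j j')) = {j} := by
        ext x
        simp only [mem_filter, mem_univ, true_and, mem_singleton]
        exact ⟨fun h => (hinj _ _ h).symm, fun h => h ▸ fun _ _ => rfl⟩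
      have e2 : (Finset.univ.filter (fun b : Fin c => c ≤ (b : ℕ))) = ∅ := by
        ext x
        simp
      rw [e1, e2]
      simp
    simp [h1]
  | succ n ih =>
    intro c hc hk
    -- the unswapped case
    have key : ∀ p q p' q' : J, SameLabels S c p q p' q' → ∀ b : Fin k, (b : ℕ) = c →
        stage S b p = stage S b p' → stage S b q = stage S b q' →
        interp S c p * interp S c q = interp S c p' * interp S c q' := by
      rintro p q p' q' h b rfl e1 e2
      rw [interp_eq, interp_eq, interp_eq, interp_eq, Finset.sum_mul_sum, Finset.sum_mul_sum,
        ← e1, ← e2]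
      refine Finset.sum_congr rfl fun i hi => Finset.sum_congr rfl fun i' hi' => ?_
      have hi2 := e1 ▸ hi
      have hi2' := e2 ▸ hi'
      simp only [stage, mem_image, mem_filter, mem_univ, true_and] at hi hi' hi2 hi2'
      obtain ⟨x, hx, rfl⟩ := hi
      obtain ⟨y, hy, rfl⟩ := hi'
      obtain ⟨x', hx', ex⟩ := hi2
      obtain ⟨y', hy', ey⟩ := hi2'
      have hrec := ih ((b : ℕ) + 1) (by omega) (by omega) x y x' y' (by
        intro a ha
        rcases Nat.lt_succ_iff_lt_or_eq.1 ha with ha | ha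
        · rw [← hx a ha, ← hy a ha, ← hx' a ha, ← hy' a ha]
          exact h a ha
        · obtain rfl : a = b := Fin.ext ha
          exact Or.inl ⟨ex.symm, ey.symm⟩)
      rw [childSum_eq S b p x hx, childSum_eq S b q y hy]
      rw [← childSum_eq S b p' x' hx', ← childSum_eq S b q' y' hy', ex, ey] at hrec
      rw [mul_mul_mul_comm, hrec, mul_mul_mul_comm]
    intro p q p' q' h
    have hlt : c < k := by omega
    rcases hst ⟨c, hlt⟩ hc p q p' q' h with ⟨e1, e2⟩ | ⟨e1, e2⟩
    · exact key p q p' q' h ⟨c, hlt⟩ rfl e1 e2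
    · rw [key p q q' p' (fun a ha => (h a ha).symm) ⟨c, hlt⟩ rfl e1 e2, mul_comm]

end PM

open Finset PM in
/-- Theorem 4.8.  Let `A` (encoded by `S`) be a multipartition matrix
with `k` blocks satisfying the GRIP, and let `Ā` (encoded by `Sbar`, with `mbar`
columns) be the matrix obtained from `A` by removing all repeated columns (`r` collapses
each column of `A` onto the corresponding column of `Ā`).  Then `Ā` is staged and
balanced; that is, the tree `T_A` associated to `A` is a stratified, balanced staged
tree. -/
theorem grip_implies_balanced {k m mbar : ℕ} (S : Fin k → Fin m → ℕ) (hgrip : GRIP S)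
    (Sbar : Fin k → Fin mbar → ℕ) (r : Fin m → Fin mbar)
    (hr : Function.Surjective r)
    (hcol : ∀ (b : Fin k) (j : Fin m), Sbar b (r j) = S b j)
    (hrinj : ∀ j j' : Fin m, r j = r j' → colEquiv S k j j')
    (hrrep : ∀ j j' : Fin m, colEquiv S k j j' → r j = r j') :
    Staged Sbar ∧ Balanced Sbar := by
  have hce : ∀ ℓ j j', colEquiv Sbar ℓ (r j) (r j') ↔ colEquiv S ℓ j j' := by
    intro ℓ j j'
    simp only [colEquiv, hcol]
  have hstage : ∀ b j, stage Sbar b (r j) = stage S b j := by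
    intro b j
    ext i
    simp only [stage, mem_image, mem_filter, mem_univ, true_and]
    constructor
    · rintro ⟨x, hx, rfl⟩
      obtain ⟨y, rfl⟩ := hr x
      exact ⟨y, (hce _ _ _).1 hx, (hcol b y).symm⟩
    · rintro ⟨y, hy, rfl⟩
      exact ⟨r y, (hce _ _ _).2 hy, hcol b y⟩
  refine ⟨?_, ?_⟩
  · intro b hb x y
    obtain ⟨j, rfl⟩ := hr x
    obtain ⟨j', rfl⟩ := hr y
    rw [hstage, hstage]
    exact (hgrip b hb).2.1 j j'
  · intro b hb j j'' _ j₁ j₂ j₁'' j₂'' h1 h2 h3 h4 e1 e2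
    refine interp_pair Sbar ?_ ?_ (k - ((b : ℕ) + 1)) _ (by omega) (by omega) _ _ _ _ ?_
    · intro x y h
      obtain ⟨x, rfl⟩ := hr x
      obtain ⟨y, rfl⟩ := hr y
      exact hrrep x y ((hce _ _ _).1 h)
    · intro c hc p q p' q' h
      obtain ⟨p, rfl⟩ := hr p
      obtain ⟨q, rfl⟩ := hr q
      obtain ⟨p', rfl⟩ := hr p'
      obtain ⟨q', rfl⟩ := hr q'
      simp only [SameLabels, hcol] at h
      simp only [hstage]
      exact stage_pair S hgrip c hc p q p' q' h
    · intro a ha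
      rcases Nat.lt_succ_iff_lt_or_eq.1 ha with ha | ha
      · right
        exact ⟨(h1 a ha).symm.trans (h2 a ha), (h4 a ha).symm.trans (h3 a ha)⟩
      · obtain rfl : a = b := Fin.ext ha
        exact Or.inl ⟨e1, e2.symm⟩
end

section
/- Consider the multipartition matrix A with two blocks A^1 = [[1,1,0],[0,0,1]] and A^2 = [[1,0,0],[0,1,1]] (columns indexed 1, 2, 3), and let d = (d_1, d_2, d_3) be a vector with positive entries summing to 1. Define the IPS iterates by p^0 = ((d_1+d_2)/2, (d_1+d_2)/2, d_3) and, alternating projections onto the two blocks, p^{k}_j = p^{k−1}_j · (α·d)/(α·p^{k−1}) where α is the row of A^2 (for k odd) or of A^1 (for k even) whose support contains j. If there exists k ≥ 0 such that p^k = d (i.e., the IPS algorithm reaches the exact MLE d in finitely many steps), then d_1 = d_2. -/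
open Finset

/-- The row-selector of the block used at IPS step `n` (for `n ≥ 1`) in Example 2.7:
for odd `n` the block `A² = [[1,0,0],[0,1,1]]`, for even `n` the block
`A¹ = [[1,1,0],[0,0,1]]`. -/
def blk19 (n : ℕ) : Fin 3 → ℕ :=
  if n % 2 = 1 then ![0, 1, 1] else ![0, 0, 1]

/-- The IPS iterates of Example 2.7: `p⁰ = ((d₁+d₂)/2, (d₁+d₂)/2, d₃)` (the projection
of the uniform distribution onto the first block), and
`pⁿ_j = pⁿ⁻¹_j ⬝ (α·d)/(α·pⁿ⁻¹)` where `α` is the row of `A²` (for `n` odd) or of `A¹`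
(for `n` even) whose support contains `j`. -/
noncomputable def ips19 (d : Fin 3 → ℝ) : ℕ → Fin 3 → ℝ
  | 0 => ![(d 0 + d 1) / 2, (d 0 + d 1) / 2, d 2]
  | n + 1 => fun j =>
      ips19 d n j *
        (∑ j' : Fin 3, if blk19 (n + 1) j' = blk19 (n + 1) j then d j' else 0) /
        (∑ j' : Fin 3, if blk19 (n + 1) j' = blk19 (n + 1) j then ips19 d n j' else 0)

lemma step_odd19 (d : Fin 3 → ℝ) (n : ℕ) (hn : n % 2 = 0) :
    ips19 d (n+1) 0 = ips19 d n 0 * d 0 / ips19 d n 0 ∧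
    ips19 d (n+1) 1 = ips19 d n 1 * (d 1 + d 2) / (ips19 d n 1 + ips19 d n 2) ∧
    ips19 d (n+1) 2 = ips19 d n 2 * (d 1 + d 2) / (ips19 d n 1 + ips19 d n 2) := by
  have h : (n + 1) % 2 = 1 := by omega
  simp [ips19, blk19, h, Fin.sum_univ_three]

lemma step_even19 (d : Fin 3 → ℝ) (n : ℕ) (hn : n % 2 = 1) :
    ips19 d (n+1) 0 = ips19 d n 0 * (d 0 + d 1) / (ips19 d n 0 + ips19 d n 1) ∧
    ips19 d (n+1) 1 = ips19 d n 1 * (d 0 + d 1) / (ips19 d n 0 + ips19 d n 1) ∧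
    ips19 d (n+1) 2 = ips19 d n 2 * d 2 / ips19 d n 2 := by
  have h : (n + 1) % 2 = 0 := by omega
  simp [ips19, blk19, h, Fin.sum_univ_three]

lemma inv19 (d : Fin 3 → ℝ) (hd : ∀ j, 0 < d j) (n : ℕ) :
    (0 < ips19 d n 0 ∧ 0 < ips19 d n 1 ∧ 0 < ips19 d n 2) ∧
    (n % 2 = 0 → ips19 d n 0 + ips19 d n 1 = d 0 + d 1 ∧ ips19 d n 2 = d 2) ∧
    (n % 2 = 1 → ips19 d n 1 + ips19 d n 2 = d 1 + d 2 ∧ ips19 d n 0 = d 0) := by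
  have h0 := hd 0
  have h1 := hd 1
  have h2 := hd 2
  induction n with
  | zero =>
    simp only [ips19]
    refine ⟨⟨?_, ?_, ?_⟩, ?_, ?_⟩
    · simp; positivity
    · simp; positivity
    · simpa using h2
    · intro _; simp
    · intro h; omega
  | succ n ih =>
    obtain ⟨⟨p0, p1, p2⟩, -, -⟩ := ih
    rcases Nat.mod_two_eq_zero_or_one n with hn | hn
    · obtain ⟨e0, e1, e2⟩ := step_odd19 d n hn
      rw [e0, e1, e2]
      refine ⟨⟨by positivity, by positivity, by positivity⟩, fun h => by omega, fun _ => ⟨?_, ?_⟩⟩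
      · field_simp
      · field_simp
    · obtain ⟨e0, e1, e2⟩ := step_even19 d n hn
      rw [e0, e1, e2]
      refine ⟨⟨by positivity, by positivity, by positivity⟩, fun _ => ⟨?_, ?_⟩, fun h => by omega⟩
      · field_simp
      · field_simp

lemma back19 (d : Fin 3 → ℝ) (hd : ∀ j, 0 < d j) (n : ℕ) (h : ips19 d (n+1) = d) :
    ips19 d n = d := by
  have h0 := hd 0
  have h1 := hd 1
  have h2 := hd 2
  obtain ⟨⟨p0, p1, p2⟩, he, ho⟩ := inv19 d hd n
  have key : ips19 d n 0 = d 0 ∧ ips19 d n 1 = d 1 ∧ ips19 d n 2 = d 2 := by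
    rcases Nat.mod_two_eq_zero_or_one n with hn | hn
    · obtain ⟨-, e1, -⟩ := step_odd19 d n hn
      obtain ⟨a, b⟩ := he hn
      rw [h, b, eq_div_iff (by positivity)] at e1
      have : ips19 d n 1 = d 1 := by
        apply mul_right_cancel₀ h2.ne'
        linarith
      exact ⟨by linarith, this, b⟩
    · obtain ⟨e0, -, -⟩ := step_even19 d n hn
      obtain ⟨a, b⟩ := ho hn
      rw [h, b, eq_div_iff (by positivity)] at e0
      have : ips19 d n 1 = d 1 := by
        apply mul_left_cancel₀ h0.ne'
        linarith
      exact ⟨b, this, by linarith⟩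
  obtain ⟨a, b, c⟩ := key
  funext j
  fin_cases j
  · exact a
  · exact b
  · exact c

/-- Example 2.7.  For the multipartition matrix with blocks
`A¹ = [[1,1,0],[0,0,1]]` and `A² = [[1,0,0],[0,1,1]]` and a normalized positive data
vector `d`, if the IPS algorithm reaches the exact MLE `d` in finitely many steps, then
`d₁ = d₂`. -/
theorem ips_exact_forces_equal (d : Fin 3 → ℝ) (hd : ∀ j, 0 < d j)
    (hd1 : (∑ j, d j) = 1) (h : ∃ n : ℕ, ips19 d n = d) :
    d 0 = d 1 := by
  obtain ⟨n, h⟩ := h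
  induction n with
  | zero =>
    have a := congrFun h 0
    simp [ips19] at a
    linarith
  | succ n ih => exact ih (back19 d hd n h)
end
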